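/- arXiv:2106.00594 — 8 statements merged into one kernel-verified Lean document; each statement's English description precedes it below -/
import Mathlib

section
/- Let A ∈ ℝ^{m×n} have nonzero columns, b ∈ ℝ^m, and let x̃ ∈ ℝ^n satisfy AᵀAx̃ = Aᵀb (a least-squares solution of min‖Ax − b‖²). For any x ∈ ℝ^n with residual r = b − Ax and any column index i, the coordinate descent update x⁺ = x + (⟨A_i, r⟩ / ‖A_i‖²) e_i satisfies ‖x⁺ − x̃‖²_{AᵀA} = ‖x − x̃‖²_{AᵀA} − (A_iᵀ r)² / ‖A_i‖². -/
open Matrix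

/-- One coordinate descent step:
`‖x⁺ − x̃‖²_{AᵀA} = ‖x − x̃‖²_{AᵀA} − (A_iᵀ r)²/‖A_i‖²`. -/
theorem stmt_2 {m n : ℕ} (A : Matrix (Fin m) (Fin n) ℝ)
    (hcol : ∀ j : Fin n, Aᵀ j ≠ 0)
    (b : Fin m → ℝ) (xtil : Fin n → ℝ)
    (hls : (Aᵀ * A).mulVec xtil = Aᵀ.mulVec b)
    (x : Fin n → ℝ) (r : Fin m → ℝ) (hr : r = b - A.mulVec x)
    (i : Fin n) (xplus : Fin n → ℝ)
    (hx : xplus = x + ((Aᵀ i ⬝ᵥ r) / (Aᵀ i ⬝ᵥ Aᵀ i)) • (Pi.single i 1 : Fin n → ℝ)) :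
    A.mulVec (xplus - xtil) ⬝ᵥ A.mulVec (xplus - xtil)
      = A.mulVec (x - xtil) ⬝ᵥ A.mulVec (x - xtil)
        - (Aᵀ i ⬝ᵥ r) ^ 2 / (Aᵀ i ⬝ᵥ Aᵀ i) := by
  have hne : Aᵀ i ⬝ᵥ Aᵀ i ≠ 0 := dotProduct_self_eq_zero.not.mpr (hcol i)
  have hnormal : Aᵀ i ⬝ᵥ A.mulVec xtil = Aᵀ i ⬝ᵥ b := by
    have h := congrFun hls i
    rwa [← mulVec_mulVec] at h
  have hres : Aᵀ i ⬝ᵥ A.mulVec (x - xtil) = -(Aᵀ i ⬝ᵥ r) := by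
    rw [hr, mulVec_sub, dotProduct_sub, dotProduct_sub, hnormal]
    ring
  have hstep : A.mulVec (xplus - xtil)
      = A.mulVec (x - xtil) + ((Aᵀ i ⬝ᵥ r) / (Aᵀ i ⬝ᵥ Aᵀ i)) • Aᵀ i := by
    rw [hx, add_sub_right_comm, mulVec_add, mulVec_smul, mulVec_single_one]
    rfl
  rw [hstep, add_dotProduct, dotProduct_add, dotProduct_add, smul_dotProduct, smul_dotProduct,
    dotProduct_smul, dotProduct_smul, dotProduct_comm (A.mulVec (x - xtil)) (Aᵀ i), hres]
  simp only [smul_eq_mul]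
  field_simp
  ring
end

section
/- Let A ∈ ℝ^{m×n} have nonzero columns, b ∈ ℝ^m, x ∈ ℝ^n with residual r = b − Ax, and let i, j be column indices with g = ‖A_j‖² − ⟨A_j, A_i⟩²/‖A_i‖² > 0. Suppose A_iᵀ r = 0. Then the GSO update x⁺ = x + α e_j + β e_i with α = (A_jᵀ r)/g and β = −(⟨A_i, A_j⟩/‖A_i‖²) α, with new residual r⁺ = b − Ax⁺, satisfies both A_jᵀ r⁺ = 0 and A_iᵀ r⁺ = 0. -/
open Matrix

/-- A GSO update with `A_iᵀ r = 0` makes the new residual orthogonal to both `A_j` and `A_i`. -/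
theorem stmt_3 {m n : ℕ} (A : Matrix (Fin m) (Fin n) ℝ)
    (hcol : ∀ j : Fin n, Aᵀ j ≠ 0)
    (b : Fin m → ℝ) (x : Fin n → ℝ) (r : Fin m → ℝ) (hr : r = b - A.mulVec x)
    (i j : Fin n) (g : ℝ)
    (hgdef : g = Aᵀ j ⬝ᵥ Aᵀ j - (Aᵀ j ⬝ᵥ Aᵀ i) ^ 2 / (Aᵀ i ⬝ᵥ Aᵀ i))
    (hg : 0 < g)
    (hir : Aᵀ i ⬝ᵥ r = 0)
    (α β : ℝ) (hα : α = (Aᵀ j ⬝ᵥ r) / g)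
    (hβ : β = -((Aᵀ i ⬝ᵥ Aᵀ j) / (Aᵀ i ⬝ᵥ Aᵀ i)) * α)
    (xplus : Fin n → ℝ)
    (hx : xplus = x + α • (Pi.single j 1 : Fin n → ℝ) + β • (Pi.single i 1 : Fin n → ℝ))
    (rplus : Fin m → ℝ) (hrplus : rplus = b - A.mulVec xplus) :
    Aᵀ j ⬝ᵥ rplus = 0 ∧ Aᵀ i ⬝ᵥ rplus = 0 := by
  have hd : Aᵀ i ⬝ᵥ Aᵀ i ≠ 0 := fun h => hcol i (dotProduct_self_eq_zero.mp h)
  have hup : rplus = r - α • Aᵀ j - β • Aᵀ i := by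
    subst hrplus hx hr
    ext k
    simp [Matrix.mulVec_add, Matrix.mulVec_smul]
    ring
  have hdot (v : Fin m → ℝ) :
      v ⬝ᵥ rplus = v ⬝ᵥ r - α * (v ⬝ᵥ Aᵀ j) - β * (v ⬝ᵥ Aᵀ i) := by
    rw [hup, dotProduct_sub, dotProduct_sub, dotProduct_smul, dotProduct_smul,
      smul_eq_mul, smul_eq_mul]
  have hαg : α * g = Aᵀ j ⬝ᵥ r := by rw [hα, div_mul_cancel₀ _ hg.ne']
  rw [dotProduct_comm (Aᵀ i) (Aᵀ j)] at hβ
  constructor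
  · rw [hdot, ← hαg, hgdef, hβ]
    ring
  · rw [hdot, hir, hβ, dotProduct_comm (Aᵀ i) (Aᵀ j)]
    field_simp
    ring
end

section
/- Let A ∈ ℝ^{m×n} have nonzero columns, b ∈ ℝ^m, and let x̃ ∈ ℝ^n satisfy AᵀAx̃ = Aᵀb. Let x ∈ ℝ^n with residual r = b − Ax, and let i, j be column indices with g = ‖A_j‖² − ⟨A_j, A_i⟩²/‖A_i‖² > 0 and A_iᵀ r = 0. Then the GSO update x⁺ = x + α e_j + β e_i with α = (A_jᵀ r)/g and β = −(⟨A_i, A_j⟩/‖A_i‖²) α satisfies ‖x⁺ − x̃‖²_{AᵀA} = ‖x − x̃‖²_{AᵀA} − (A_jᵀ r)² / g. -/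
open Matrix

/-- If `A x̃` is a least-squares fit to `b`, then every column of `A` sees the error `A (x - x̃)` as
the negative of the residual `b - A x`. -/
lemma col_dotProduct_mulVec_sub_of_normalEq {m n : ℕ} {A : Matrix (Fin m) (Fin n) ℝ}
    {b : Fin m → ℝ} {y : Fin n → ℝ} (hy : (Aᵀ * A).mulVec y = Aᵀ.mulVec b)
    (x : Fin n → ℝ) (k : Fin n) :
    Aᵀ k ⬝ᵥ A.mulVec (x - y) = -(Aᵀ k ⬝ᵥ (b - A.mulVec x)) := by
  have h : Aᵀ k ⬝ᵥ A.mulVec y = Aᵀ k ⬝ᵥ b := by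
    rw [← mulVec_mulVec] at hy
    exact congrFun hy k
  rw [mulVec_sub, dotProduct_sub, dotProduct_sub, h, neg_sub]

lemma dotProduct_self_add_smul_add_smul {m : ℕ} (d u v : Fin m → ℝ) (s t : ℝ) :
    (d + s • u + t • v) ⬝ᵥ (d + s • u + t • v)
      = d ⬝ᵥ d + 2 * s * (u ⬝ᵥ d) + 2 * t * (v ⬝ᵥ d)
        + s ^ 2 * (u ⬝ᵥ u) + 2 * s * t * (u ⬝ᵥ v) + t ^ 2 * (v ⬝ᵥ v) := by
  simp only [add_dotProduct, dotProduct_add, smul_dotProduct, dotProduct_smul, smul_eq_mul]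
  rw [dotProduct_comm d u, dotProduct_comm d v, dotProduct_comm v u]
  ring

/-- One GSO step: `‖x⁺ − x̃‖²_{AᵀA} = ‖x − x̃‖²_{AᵀA} − (A_jᵀ r)²/g`. -/
theorem stmt_5 {m n : ℕ} (A : Matrix (Fin m) (Fin n) ℝ)
    (hcol : ∀ j : Fin n, Aᵀ j ≠ 0)
    (b : Fin m → ℝ) (xtil : Fin n → ℝ)
    (hls : (Aᵀ * A).mulVec xtil = Aᵀ.mulVec b)
    (x : Fin n → ℝ) (r : Fin m → ℝ) (hr : r = b - A.mulVec x)
    (i j : Fin n) (g : ℝ)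
    (hgdef : g = Aᵀ j ⬝ᵥ Aᵀ j - (Aᵀ j ⬝ᵥ Aᵀ i) ^ 2 / (Aᵀ i ⬝ᵥ Aᵀ i))
    (hg : 0 < g)
    (hir : Aᵀ i ⬝ᵥ r = 0)
    (α β : ℝ) (hα : α = (Aᵀ j ⬝ᵥ r) / g)
    (hβ : β = -((Aᵀ i ⬝ᵥ Aᵀ j) / (Aᵀ i ⬝ᵥ Aᵀ i)) * α)
    (xplus : Fin n → ℝ)
    (hx : xplus = x + α • (Pi.single j 1 : Fin n → ℝ) + β • (Pi.single i 1 : Fin n → ℝ)) :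
    A.mulVec (xplus - xtil) ⬝ᵥ A.mulVec (xplus - xtil)
      = A.mulVec (x - xtil) ⬝ᵥ A.mulVec (x - xtil) - (Aᵀ j ⬝ᵥ r) ^ 2 / g := by
  have hii : Aᵀ i ⬝ᵥ Aᵀ i ≠ 0 := fun h => hcol i (dotProduct_self_eq_zero.mp h)
  have hj := col_dotProduct_mulVec_sub_of_normalEq hls x j
  have hi := col_dotProduct_mulVec_sub_of_normalEq hls x i
  rw [← hr] at hj hi
  rw [hir, neg_zero] at hi
  have hplus : A.mulVec (xplus - xtil) = A.mulVec (x - xtil) + α • Aᵀ j + β • Aᵀ i := by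
    have : xplus - xtil = (x - xtil) + α • (Pi.single j 1 : Fin n → ℝ)
        + β • (Pi.single i 1 : Fin n → ℝ) := by
      rw [hx]; abel
    rw [this, mulVec_add, mulVec_add, mulVec_smul, mulVec_smul, mulVec_single_one,
      mulVec_single_one]
    rfl
  have hαg : α * g = Aᵀ j ⬝ᵥ r := by rw [hα, div_mul_cancel₀ _ hg.ne']
  have hquad : α ^ 2 * (Aᵀ j ⬝ᵥ Aᵀ j) + 2 * α * β * (Aᵀ j ⬝ᵥ Aᵀ i) + β ^ 2 * (Aᵀ i ⬝ᵥ Aᵀ i)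
      = α ^ 2 * g := by
    rw [hβ, hgdef, dotProduct_comm (Aᵀ i) (Aᵀ j)]
    field_simp
    ring
  have hdiv : (Aᵀ j ⬝ᵥ r) ^ 2 / g = α ^ 2 * g := by
    rw [← hαg]
    field_simp
  rw [hplus, dotProduct_self_add_smul_add_smul, hj, hi, hdiv, ← hαg]
  linear_combination hquad
end

section
/- Let A ∈ ℝ^{m×n} have nonzero columns, and let r ∈ ℝ^m and column indices i, j be such that g = ‖A_j‖² − ⟨A_j, A_i⟩²/‖A_i‖² > 0. Then the per-step decrease of the GSO method is at least that of the CD method: (A_jᵀ r)² / g ≥ (A_jᵀ r)² / ‖A_j‖², with strict inequality whenever ⟨A_i, A_j⟩ ≠ 0 and A_jᵀ r ≠ 0, and with equality whenever ⟨A_i, A_j⟩ = 0. -/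
open Matrix

/-- The per-step decrease of GSO dominates that of CD:
`(A_jᵀ r)²/g ≥ (A_jᵀ r)²/‖A_j‖²`, strictly when `⟨A_i,A_j⟩ ≠ 0` and `A_jᵀ r ≠ 0`,
with equality when `⟨A_i,A_j⟩ = 0`. -/
theorem stmt_6 {m n : ℕ} (A : Matrix (Fin m) (Fin n) ℝ)
    (hcol : ∀ j : Fin n, Aᵀ j ≠ 0)
    (r : Fin m → ℝ) (i j : Fin n) (g : ℝ)
    (hgdef : g = Aᵀ j ⬝ᵥ Aᵀ j - (Aᵀ j ⬝ᵥ Aᵀ i) ^ 2 / (Aᵀ i ⬝ᵥ Aᵀ i))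
    (hg : 0 < g) :
    (Aᵀ j ⬝ᵥ r) ^ 2 / g ≥ (Aᵀ j ⬝ᵥ r) ^ 2 / (Aᵀ j ⬝ᵥ Aᵀ j) ∧
    (Aᵀ i ⬝ᵥ Aᵀ j ≠ 0 → Aᵀ j ⬝ᵥ r ≠ 0 →
      (Aᵀ j ⬝ᵥ r) ^ 2 / g > (Aᵀ j ⬝ᵥ r) ^ 2 / (Aᵀ j ⬝ᵥ Aᵀ j)) ∧
    (Aᵀ i ⬝ᵥ Aᵀ j = 0 →
      (Aᵀ j ⬝ᵥ r) ^ 2 / g = (Aᵀ j ⬝ᵥ r) ^ 2 / (Aᵀ j ⬝ᵥ Aᵀ j)) := by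
  have hi : 0 < Aᵀ i ⬝ᵥ Aᵀ i :=
    lt_of_le_of_ne (Finset.sum_nonneg fun k _ => mul_self_nonneg (Aᵀ i k))
      fun h => hcol i (dotProduct_self_eq_zero.mp h.symm)
  have hle : g ≤ Aᵀ j ⬝ᵥ Aᵀ j := hgdef ▸ sub_le_self _ (by positivity)
  refine ⟨div_le_div_of_nonneg_left (sq_nonneg _) hg hle, fun hij hr => ?_, fun hij => ?_⟩
  · rw [dotProduct_comm] at hij
    have hlt : g < Aᵀ j ⬝ᵥ Aᵀ j := hgdef ▸ sub_lt_self _ (by positivity)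
    exact div_lt_div_of_pos_left (by positivity) hg hlt
  · rw [hgdef, dotProduct_comm (Aᵀ j) (Aᵀ i), hij]
    simp
end

section
/- (Lemma 3.1) Let A ∈ ℝ^{m×n} (n ≥ 3) have nonzero columns, b ∈ ℝ^m, and let x̃ ∈ ℝ^n satisfy AᵀAx̃ = Aᵀb. Let σ_min(A) denote the smallest nonzero singular value of A. Let x ∈ ℝ^n with residual r = b − Ax, and let i_{k−1}, i_k be two distinct column indices such that A_{i_k}ᵀ r = 0, A_{i_{k−1}}ᵀ r = 0, and such that ‖A_s‖² − ⟨A_s, A_{i_k}⟩²/‖A_{i_k}‖² > 0 for every column index s ∉ {i_k, i_{k−1}}. Then the uniform average over s ∉ {i_k, i_{k−1}} satisfies (1/(n−2)) Σ_{s ≠ i_k, i_{k−1}} (A_sᵀ r)² / (‖A_s‖² − ⟨A_s, A_{i_k}⟩²/‖A_{i_k}‖²) ≥ σ_min²(A) ‖x̃ − x‖²_{AᵀA} / ((n−2)(‖A‖_F² − σ_min²(A))). -/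
open Matrix

/-- If every nonzero eigenvalue of `Aᵀ * A` is at least `c`, then `‖Aᵀ w‖² ≥ c ‖w‖²` for every `w`
in the range of `A`. -/
theorem mul_dotProduct_mulVec_le_of_eigenvalue_bound {m n : ℕ} (A : Matrix (Fin m) (Fin n) ℝ)
    {c : ℝ} (hc : ∀ t : ℝ, t ≠ 0 → ∀ v : Fin n → ℝ, v ≠ 0 → (Aᵀ * A) *ᵥ v = t • v → c ≤ t)
    (y : Fin n → ℝ) :
    c * (A *ᵥ y ⬝ᵥ A *ᵥ y) ≤ Aᵀ *ᵥ (A *ᵥ y) ⬝ᵥ Aᵀ *ᵥ (A *ᵥ y) := by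
  have hG : (Aᵀ * A).PosSemidef := by
    simpa using posSemidef_conjTranspose_mul_self A
  have hsymm : (Aᵀ * A)ᵀ = Aᵀ * A := by simp
  set G := Aᵀ * A with hGdef
  have hGy : Aᵀ *ᵥ (A *ᵥ y) = G *ᵥ y := by rw [mulVec_mulVec]
  have hAy : A *ᵥ y ⬝ᵥ A *ᵥ y = y ⬝ᵥ G *ᵥ y := by
    rw [← hGy, dotProduct_mulVec y, vecMul_transpose]
  rw [hGy, hAy]
  let e := hG.isHermitian.eigenvectorBasis
  let l := hG.isHermitian.eigenvalues
  have he (i : Fin n) : G *ᵥ (e i).ofLp = l i • (e i).ofLp :=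
    hG.isHermitian.mulVec_eigenvectorBasis i
  have parseval (u v : Fin n → ℝ) :
      u ⬝ᵥ v = ∑ i, (u ⬝ᵥ (e i).ofLp) * (v ⬝ᵥ (e i).ofLp) := by
    have := e.sum_inner_mul_inner (WithLp.toLp 2 u) (WithLp.toLp 2 v)
    simp only [EuclideanSpace.inner_eq_star_dotProduct, star_trivial] at this
    rw [dotProduct_comm, ← this]
    refine Finset.sum_congr rfl fun i _ => ?_
    rw [dotProduct_comm u]
  have hcoord (i : Fin n) : G *ᵥ y ⬝ᵥ (e i).ofLp = l i * (y ⬝ᵥ (e i).ofLp) := by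
    rw [dotProduct_comm, dotProduct_mulVec, ← mulVec_transpose, hsymm, he, smul_dotProduct,
      dotProduct_comm, smul_eq_mul]
  rw [parseval y, parseval (G *ᵥ y), Finset.mul_sum]
  refine Finset.sum_le_sum fun i _ => ?_
  rw [hcoord]
  have hl : c * l i ≤ l i * l i := by
    rcases eq_or_ne (l i) 0 with h | h
    · simp [h]
    · refine mul_le_mul_of_nonneg_right (hc _ h (e i).ofLp ?_ (he i)) (hG.eigenvalues_nonneg i)
      intro h0
      exact e.orthonormal.ne_zero i (WithLp.ofLp_injective 2 h0)
  nlinarith [mul_le_mul_of_nonneg_right hl (sq_nonneg (y ⬝ᵥ (e i).ofLp))]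

/-- Cauchy–Schwarz: orthogonalising `u` against `v` leaves a nonnegative squared norm. -/
theorem dotProduct_self_sub_sq_div_nonneg {m : ℕ} (u v : Fin m → ℝ) :
    0 ≤ u ⬝ᵥ u - (u ⬝ᵥ v) ^ 2 / (v ⬝ᵥ v) := by
  have hcs : (u ⬝ᵥ v) ^ 2 ≤ (u ⬝ᵥ u) * (v ⬝ᵥ v) := by
    simpa only [dotProduct, sq] using Finset.sum_mul_sq_le_sq_mul_sq Finset.univ u v
  have hu : 0 ≤ u ⬝ᵥ u := Finset.sum_nonneg fun i _ => mul_self_nonneg (u i)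
  have hv : 0 ≤ v ⬝ᵥ v := Finset.sum_nonneg fun i _ => mul_self_nonneg (v i)
  exact sub_nonneg.2 (div_le_of_le_mul₀ hv hu hcs)

/-- Lemma 3.1: the uniform average over `s ∉ {i_k, i_{k−1}}` of the GSO gains satisfies
`(1/(n−2)) Σ_s (A_sᵀ r)²/(‖A_s‖² − ⟨A_s,A_{i_k}⟩²/‖A_{i_k}‖²)
  ≥ σ_min²(A)‖x̃ − x‖²_{AᵀA} / ((n−2)(‖A‖_F² − σ_min²(A)))`.
Here `σmin ^ 2` is the smallest nonzero eigenvalue of `AᵀA`. -/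
theorem stmt_11 {m n : ℕ} (hn : 3 ≤ n) (A : Matrix (Fin m) (Fin n) ℝ)
    (hcol : ∀ j : Fin n, Aᵀ j ≠ 0)
    (b : Fin m → ℝ) (xtil : Fin n → ℝ)
    (hls : (Aᵀ * A).mulVec xtil = Aᵀ.mulVec b)
    (σmin : ℝ) (hσpos : 0 < σmin)
    (hσ : IsLeast {t : ℝ | t ≠ 0 ∧ ∃ v : Fin n → ℝ, v ≠ 0 ∧ (Aᵀ * A).mulVec v = t • v}
      (σmin ^ 2))
    (x : Fin n → ℝ) (r : Fin m → ℝ) (hr : r = b - A.mulVec x)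
    (ik ikm : Fin n) (hne : ik ≠ ikm)
    (hik : Aᵀ ik ⬝ᵥ r = 0) (hikm : Aᵀ ikm ⬝ᵥ r = 0)
    (hpos : ∀ s : Fin n, s ≠ ik → s ≠ ikm →
      0 < Aᵀ s ⬝ᵥ Aᵀ s - (Aᵀ s ⬝ᵥ Aᵀ ik) ^ 2 / (Aᵀ ik ⬝ᵥ Aᵀ ik)) :
    (1 / ((n : ℝ) - 2)) *
      ∑ s ∈ Finset.univ \ {ik, ikm},
        (Aᵀ s ⬝ᵥ r) ^ 2 / (Aᵀ s ⬝ᵥ Aᵀ s - (Aᵀ s ⬝ᵥ Aᵀ ik) ^ 2 / (Aᵀ ik ⬝ᵥ Aᵀ ik))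
    ≥ σmin ^ 2 * (A.mulVec (xtil - x) ⬝ᵥ A.mulVec (xtil - x))
      / (((n : ℝ) - 2) * ((∑ i, ∑ j, (A i j) ^ 2) - σmin ^ 2)) := by
  have hbound := mul_dotProduct_mulVec_le_of_eigenvalue_bound A (c := σmin ^ 2)
    fun t ht v hv h => hσ.2 ⟨ht, v, hv, h⟩
  set w := A *ᵥ (xtil - x) with hw
  set d : Fin n → ℝ := fun s =>
    Aᵀ s ⬝ᵥ Aᵀ s - (Aᵀ s ⬝ᵥ Aᵀ ik) ^ 2 / (Aᵀ ik ⬝ᵥ Aᵀ ik) with hd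
  set D := (∑ i, ∑ j, (A i j) ^ 2) - σmin ^ 2 with hD
  have hrw : Aᵀ *ᵥ r = Aᵀ *ᵥ w := by
    rw [hr, hw, mulVec_sub, mulVec_sub, mulVec_sub, mulVec_mulVec, mulVec_mulVec, hls]
  have hsum_d : ∑ s, d s ≤ D := by
    have hpos_ik : 0 < Aᵀ ik ⬝ᵥ Aᵀ ik := by
      simpa using dotProduct_star_self_pos_iff.2 (hcol ik)
    have hfrob : ∑ i, ∑ j, (A i j) ^ 2 = ∑ s, Aᵀ s ⬝ᵥ Aᵀ s := by
      rw [Finset.sum_comm]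
      simp [dotProduct, sq]
    have hproj : σmin ^ 2 ≤ (∑ s, (Aᵀ s ⬝ᵥ Aᵀ ik) ^ 2) / (Aᵀ ik ⬝ᵥ Aᵀ ik) := by
      rw [le_div_iff₀ hpos_ik]
      have h := hbound (Pi.single ik 1)
      have hcolumn : A *ᵥ Pi.single ik 1 = Aᵀ ik := by
        ext i
        simp
      rw [hcolumn] at h
      simpa only [dotProduct, mulVec, sq] using h
    rw [hD, hfrob, hd, Finset.sum_sub_distrib, ← Finset.sum_div]
    linarith
  have hd_le (s : Fin n) : d s ≤ D :=
    (Finset.single_le_sum (fun j _ => dotProduct_self_sub_sq_div_nonneg (Aᵀ j) (Aᵀ ik))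
      (Finset.mem_univ s)).trans hsum_d
  have hgain : σmin ^ 2 * (w ⬝ᵥ w) ≤ ∑ s ∈ Finset.univ \ {ik, ikm}, (Aᵀ s ⬝ᵥ r) ^ 2 := by
    have hall : ∑ s ∈ Finset.univ \ {ik, ikm}, (Aᵀ s ⬝ᵥ r) ^ 2 = ∑ s, (Aᵀ s ⬝ᵥ r) ^ 2 := by
      refine Finset.sum_subset (Finset.subset_univ _) fun s _ hs => ?_
      have : s = ik ∨ s = ikm := by simpa [or_iff_not_imp_left] using hs
      rcases this with rfl | rfl <;> simp [hik, hikm]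
    have hnorm : ∑ s, (Aᵀ s ⬝ᵥ r) ^ 2 = Aᵀ *ᵥ r ⬝ᵥ Aᵀ *ᵥ r := by
      simp only [dotProduct, mulVec, sq]
    rw [hall, hnorm, hrw]
    exact hbound (xtil - x)
  have hn2 : (0 : ℝ) < (n : ℝ) - 2 := by
    have : (3 : ℝ) ≤ n := by exact_mod_cast hn
    linarith
  rw [ge_iff_le, div_mul_eq_div_div_swap, one_div, inv_mul_eq_div]
  refine div_le_div_of_nonneg_right ?_ hn2.le
  obtain ⟨s₀, hs₀, hs₀'⟩ : ∃ s : Fin n, s ≠ ik ∧ s ≠ ikm := by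
    have hcard : ({ik, ikm} : Finset (Fin n)).card < (Finset.univ : Finset (Fin n)).card := by
      rw [Finset.card_pair hne, Finset.card_fin]
      omega
    obtain ⟨s, -, hs⟩ := Finset.exists_mem_notMem_of_card_lt_card hcard
    exact ⟨s, by simpa using hs⟩
  have hDpos : 0 < D := (hpos s₀ hs₀ hs₀').trans_le (hd_le s₀)
  calc σmin ^ 2 * (w ⬝ᵥ w) / D
      ≤ (∑ s ∈ Finset.univ \ {ik, ikm}, (Aᵀ s ⬝ᵥ r) ^ 2) / D := by gcongr
    _ = ∑ s ∈ Finset.univ \ {ik, ikm}, (Aᵀ s ⬝ᵥ r) ^ 2 / D := Finset.sum_div _ _ _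
    _ ≤ ∑ s ∈ Finset.univ \ {ik, ikm}, (Aᵀ s ⬝ᵥ r) ^ 2 / d s := by
      refine Finset.sum_le_sum fun s hs => ?_
      have hs' : s ≠ ik ∧ s ≠ ikm := by simpa using hs
      exact div_le_div_of_nonneg_left (sq_nonneg _) (hpos s hs'.1 hs'.2) (hd_le s)
end

section
/- (Theorem 3.2, one-step contraction) Let A ∈ ℝ^{m×n} (n ≥ 3) have nonzero columns, b ∈ ℝ^m, and let x̃ ∈ ℝ^n satisfy AᵀAx̃ = Aᵀb. Define F(x) = ‖Ax − b‖² and δ(x) = F(x) − F(x̃). Let x ∈ ℝ^n with residual r = b − Ax, and let i_{k−1}, i_k be two distinct column indices such that A_{i_k}ᵀ r = 0, A_{i_{k−1}}ᵀ r = 0, and ‖A_s‖² − ⟨A_s, A_{i_k}⟩²/‖A_{i_k}‖² > 0 for every s ∉ {i_k, i_{k−1}}. For each such s, let x⁺(s) = x + α_s e_s + β_s e_{i_k}, where g_s = ‖A_s‖² − ⟨A_s, A_{i_k}⟩²/‖A_{i_k}‖², α_s = (A_sᵀ r)/g_s, β_s = −(⟨A_{i_k}, A_s⟩/‖A_{i_k}‖²)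 α_s. Then the uniform average over s ∉ {i_k, i_{k−1}} satisfies (1/(n−2)) Σ_{s ≠ i_k, i_{k−1}} δ(x⁺(s)) ≤ (1 − 1/((n−2)(κ_F²(A) − 1))) δ(x), where κ_F(A) = ‖A‖_F / σ_min(A). -/
open Matrix

/-- Parseval's identity in the eigenbasis of a symmetric real matrix, for the dot product. -/
lemma Matrix.IsHermitian.sum_dotProduct_eigenvectorBasis {n : ℕ} {M : Matrix (Fin n) (Fin n) ℝ}
    (hM : M.IsHermitian) (u v : Fin n → ℝ) :
    ∑ i, (u ⬝ᵥ ⇑(hM.eigenvectorBasis i)) * (v ⬝ᵥ ⇑(hM.eigenvectorBasis i)) = u ⬝ᵥ v := by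
  have h := hM.eigenvectorBasis.sum_inner_mul_inner (WithLp.toLp 2 v) (WithLp.toLp 2 u)
  simp only [EuclideanSpace.inner_eq_star_dotProduct, star_trivial] at h
  rw [← h]
  refine Finset.sum_congr rfl fun i _ => ?_
  rw [dotProduct_comm v, mul_comm]

lemma Matrix.dotProduct_transpose_mul_self_mulVec {m n : ℕ} (A : Matrix (Fin m) (Fin n) ℝ)
    (u v : Fin n → ℝ) : u ⬝ᵥ ((Aᵀ * A) *ᵥ v) = (A *ᵥ u) ⬝ᵥ (A *ᵥ v) := by
  rw [← mulVec_mulVec, dotProduct_mulVec, vecMul_transpose]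

/-- If every nonzero eigenvalue of `AᵀA` is at least `c`, then `c ‖A v‖² ≤ ‖AᵀA v‖²`. -/
lemma Matrix.mul_dotProduct_mulVec_le {m n : ℕ} (A : Matrix (Fin m) (Fin n) ℝ) {c : ℝ}
    (hc : ∀ t : ℝ, t ≠ 0 → (∃ v : Fin n → ℝ, v ≠ 0 ∧ (Aᵀ * A) *ᵥ v = t • v) → c ≤ t)
    (v : Fin n → ℝ) :
    c * ((A *ᵥ v) ⬝ᵥ (A *ᵥ v)) ≤ ((Aᵀ * A) *ᵥ v) ⬝ᵥ ((Aᵀ * A) *ᵥ v) := by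
  have hM : (Aᵀ * A).IsHermitian := by
    simpa [conjTranspose_eq_transpose_of_trivial] using isHermitian_conjTranspose_mul_self A
  have hps : (Aᵀ * A).PosSemidef := by
    simpa [conjTranspose_eq_transpose_of_trivial] using posSemidef_conjTranspose_mul_self A
  have hw (i : Fin n) : ((Aᵀ * A) *ᵥ v) ⬝ᵥ ⇑(hM.eigenvectorBasis i)
      = hM.eigenvalues i * (v ⬝ᵥ ⇑(hM.eigenvectorBasis i)) := by
    rw [dotProduct_comm, dotProduct_transpose_mul_self_mulVec, dotProduct_comm,
      ← dotProduct_transpose_mul_self_mulVec, hM.mulVec_eigenvectorBasis, dotProduct_smul,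
      smul_eq_mul]
  have hl (i : Fin n) : c * hM.eigenvalues i ≤ hM.eigenvalues i ^ 2 := by
    by_cases h0 : hM.eigenvalues i = 0
    · simp [h0]
    · have h1 : c ≤ hM.eigenvalues i := by
        refine hc _ h0 ⟨_, ?_, hM.mulVec_eigenvectorBasis i⟩
        intro h
        exact hM.eigenvectorBasis.orthonormal.ne_zero i (PiLp.ext fun j => congrFun h j)
      nlinarith [hps.eigenvalues_nonneg i]
  rw [← dotProduct_transpose_mul_self_mulVec, ← hM.sum_dotProduct_eigenvectorBasis v,
    ← hM.sum_dotProduct_eigenvectorBasis ((Aᵀ * A) *ᵥ v), Finset.mul_sum]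
  refine Finset.sum_le_sum fun i _ => ?_
  rw [hw]
  nlinarith [mul_le_mul_of_nonneg_right (hl i) (sq_nonneg (v ⬝ᵥ ⇑(hM.eigenvectorBasis i)))]

/-- Theorem 3.2 (one-step contraction): the uniform average over `s ∉ {i_k, i_{k−1}}` of
`δ(x⁺(s))` is at most `(1 − 1/((n−2)(κ_F²(A) − 1))) δ(x)`, where `κ_F(A) = ‖A‖_F/σ_min(A)`. -/
theorem stmt_12 {m n : ℕ} (hn : 3 ≤ n) (A : Matrix (Fin m) (Fin n) ℝ)
    (hcol : ∀ j : Fin n, Aᵀ j ≠ 0)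
    (b : Fin m → ℝ) (xtil : Fin n → ℝ)
    (hls : (Aᵀ * A).mulVec xtil = Aᵀ.mulVec b)
    (σmin : ℝ) (hσpos : 0 < σmin)
    (hσ : IsLeast {t : ℝ | t ≠ 0 ∧ ∃ v : Fin n → ℝ, v ≠ 0 ∧ (Aᵀ * A).mulVec v = t • v}
      (σmin ^ 2))
    (κ : ℝ) (hκ : κ = Real.sqrt (∑ i, ∑ j, (A i j) ^ 2) / σmin)
    (F : (Fin n → ℝ) → ℝ)
    (hF : ∀ y, F y = (A.mulVec y - b) ⬝ᵥ (A.mulVec y - b))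
    (δ : (Fin n → ℝ) → ℝ) (hδ : ∀ y, δ y = F y - F xtil)
    (x : Fin n → ℝ) (r : Fin m → ℝ) (hr : r = b - A.mulVec x)
    (ik ikm : Fin n) (hne : ik ≠ ikm)
    (hik : Aᵀ ik ⬝ᵥ r = 0) (hikm : Aᵀ ikm ⬝ᵥ r = 0)
    (g α β : Fin n → ℝ)
    (hg : ∀ s, g s = Aᵀ s ⬝ᵥ Aᵀ s - (Aᵀ s ⬝ᵥ Aᵀ ik) ^ 2 / (Aᵀ ik ⬝ᵥ Aᵀ ik))
    (hpos : ∀ s : Fin n, s ≠ ik → s ≠ ikm → 0 < g s)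
    (hα : ∀ s, α s = (Aᵀ s ⬝ᵥ r) / g s)
    (hβ : ∀ s, β s = -((Aᵀ ik ⬝ᵥ Aᵀ s) / (Aᵀ ik ⬝ᵥ Aᵀ ik)) * α s)
    (xplus : Fin n → Fin n → ℝ)
    (hxplus : ∀ s : Fin n, s ≠ ik → s ≠ ikm →
      xplus s = x + α s • (Pi.single s 1 : Fin n → ℝ) + β s • (Pi.single ik 1 : Fin n → ℝ)) :
    (1 / ((n : ℝ) - 2)) * ∑ s ∈ Finset.univ \ {ik, ikm}, δ (xplus s)
      ≤ (1 - 1 / (((n : ℝ) - 2) * (κ ^ 2 - 1))) * δ x := by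
  have hspec := A.mul_dotProduct_mulVec_le (c := σmin ^ 2) fun t ht hv => hσ.2 ⟨ht, hv⟩
  have hcolpos (j : Fin n) : 0 < Aᵀ j ⬝ᵥ Aᵀ j := by
    rcases (show 0 ≤ Aᵀ j ⬝ᵥ Aᵀ j from
      Finset.sum_nonneg fun i _ => mul_self_nonneg _).lt_or_eq with h | h
    · exact h
    · exact absurd (dotProduct_self_eq_zero.1 h.symm) (hcol j)
  have hd := hcolpos ik
  have hnormal : Aᵀ *ᵥ r = (Aᵀ * A) *ᵥ (xtil - x) := by
    rw [hr, mulVec_sub, mulVec_sub, hls, mulVec_mulVec]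
  have hδx : δ x = (A *ᵥ (xtil - x)) ⬝ᵥ (A *ᵥ (xtil - x)) := by
    have horth : (A *ᵥ (xtil - x)) ⬝ᵥ (A *ᵥ xtil - b) = 0 := by
      rw [← vecMul_transpose, ← dotProduct_mulVec, mulVec_sub, mulVec_mulVec, hls, sub_self,
        dotProduct_zero]
    have hx : A *ᵥ x - b = (A *ᵥ xtil - b) - A *ᵥ (xtil - x) := by
      rw [mulVec_sub]; abel
    rw [hδ, hF, hF, hx]
    generalize A *ᵥ xtil - b = p at *
    generalize A *ᵥ (xtil - x) = q at *
    simp only [sub_dotProduct, dotProduct_sub, dotProduct_comm p q, horth]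
    ring
  have hδnn : 0 ≤ δ x := by
    rw [hδx]
    exact Finset.sum_nonneg fun i _ => mul_self_nonneg _
  have hstep (s : Fin n) (h1 : s ≠ ik) (h2 : s ≠ ikm) :
      δ (xplus s) = δ x - (Aᵀ s ⬝ᵥ r) ^ 2 / g s := by
    have hgs := hpos s h1 h2
    have hcolS (j : Fin n) : A *ᵥ (Pi.single j 1 : Fin n → ℝ) = Aᵀ j := by
      rw [mulVec_single_one]; rfl
    have hres : A *ᵥ xplus s - b = α s • Aᵀ s + β s • Aᵀ ik - r := by
      rw [hxplus s h1 h2, mulVec_add, mulVec_add, mulVec_smul, mulVec_smul, hcolS, hcolS, hr]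
      abel
    have hrx : A *ᵥ x - b = -r := by rw [hr]; abel
    rw [hδ, hδ, hF, hF x, hres, hrx]
    have hβs := hβ s
    have hαs := hα s
    have hgd := hg s
    rw [dotProduct_comm (Aᵀ ik) (Aᵀ s)] at hβs
    simp only [sub_dotProduct, dotProduct_sub, add_dotProduct, dotProduct_add, smul_dotProduct,
      dotProduct_smul, smul_eq_mul, neg_dotProduct, dotProduct_neg, dotProduct_comm r,
      dotProduct_comm (Aᵀ ik) (Aᵀ s), hik]
    generalize Aᵀ s ⬝ᵥ Aᵀ s = a at *
    generalize Aᵀ s ⬝ᵥ Aᵀ ik = e at *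
    generalize Aᵀ ik ⬝ᵥ Aᵀ ik = d at *
    generalize Aᵀ s ⬝ᵥ r = c at *
    have ha : a = g s + e ^ 2 / d := by linarith
    rw [hβs, hαs, ha]
    field_simp
    ring
  have hgnn (s : Fin n) : 0 ≤ g s := by
    have hcs : (Aᵀ s ⬝ᵥ Aᵀ ik) ^ 2 ≤ (Aᵀ s ⬝ᵥ Aᵀ s) * (Aᵀ ik ⬝ᵥ Aᵀ ik) := by
      simpa [dotProduct, sq] using
        Finset.sum_mul_sq_le_sq_mul_sq Finset.univ (Aᵀ s) (Aᵀ ik)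
    rw [hg, sub_nonneg, div_le_iff₀ hd]
    exact hcs
  set N := ∑ i, ∑ j, (A i j) ^ 2 with hN
  have hsumg : ∑ s, g s ≤ N - σmin ^ 2 := by
    have h := hspec (Pi.single ik 1)
    have hcolik : A *ᵥ (Pi.single ik 1 : Fin n → ℝ) = Aᵀ ik := by
      rw [mulVec_single_one]; rfl
    rw [← mulVec_mulVec, hcolik] at h
    have hsq : (Aᵀ *ᵥ Aᵀ ik) ⬝ᵥ (Aᵀ *ᵥ Aᵀ ik) = ∑ s, (Aᵀ s ⬝ᵥ Aᵀ ik) ^ 2 :=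
      Finset.sum_congr rfl fun s _ => (sq _).symm
    have hNcol : N = ∑ s, Aᵀ s ⬝ᵥ Aᵀ s := by
      rw [hN, Finset.sum_comm]
      simp [dotProduct, sq]
    have hdiv : σmin ^ 2 ≤ (∑ s, (Aᵀ s ⬝ᵥ Aᵀ ik) ^ 2) / (Aᵀ ik ⬝ᵥ Aᵀ ik) := by
      rw [le_div_iff₀ hd, ← hsq]
      exact h
    simp only [hg, Finset.sum_sub_distrib, ← Finset.sum_div]
    linarith
  have hgle (s : Fin n) : g s ≤ N - σmin ^ 2 :=
    (Finset.single_le_sum (fun i _ => hgnn i) (Finset.mem_univ s)).trans hsumg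
  have hcard : ((Finset.univ \ {ik, ikm} : Finset (Fin n)).card : ℝ) = (n : ℝ) - 2 := by
    rw [Finset.card_sdiff_of_subset (Finset.subset_univ _), Finset.card_pair hne, Finset.card_univ,
      Fintype.card_fin, Nat.cast_sub (by omega)]
    norm_num
  have hn2 : (0 : ℝ) < (n : ℝ) - 2 := by
    have : (3 : ℝ) ≤ n := by exact_mod_cast hn
    linarith
  have hmem {s : Fin n} (hs : s ∈ Finset.univ \ {ik, ikm}) : s ≠ ik ∧ s ≠ ikm := by
    simpa using hs
  have hgap : 0 < N - σmin ^ 2 := by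
    have hne' : (Finset.univ \ {ik, ikm} : Finset (Fin n)).Nonempty := by
      rw [← Finset.card_pos]
      exact_mod_cast hcard ▸ hn2
    obtain ⟨s, hs⟩ := hne'
    exact (hpos s (hmem hs).1 (hmem hs).2).trans_le (hgle s)
  have hκ2 : κ ^ 2 - 1 = (N - σmin ^ 2) / σmin ^ 2 := by
    have hNn : 0 ≤ N := Finset.sum_nonneg fun i _ => Finset.sum_nonneg fun j _ => sq_nonneg _
    rw [hκ, div_pow, Real.sq_sqrt hNn]
    field_simp
  have hgrad : σmin ^ 2 * δ x ≤ ∑ s ∈ Finset.univ \ {ik, ikm}, (Aᵀ s ⬝ᵥ r) ^ 2 := by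
    have hfull : ∑ s ∈ Finset.univ \ {ik, ikm}, (Aᵀ s ⬝ᵥ r) ^ 2 = ∑ s, (Aᵀ s ⬝ᵥ r) ^ 2 := by
      refine Finset.sum_subset (Finset.subset_univ _) fun s _ hs => ?_
      have hs' : s = ik ∨ s = ikm := by
        by_contra hcon
        exact hs (by simpa using hcon)
      rcases hs' with rfl | rfl
      · simp [hik]
      · simp [hikm]
    have h := hspec (xtil - x)
    rw [← hnormal, ← hδx] at h
    rw [hfull]
    exact h.trans_eq (Finset.sum_congr rfl fun s _ => (sq _).symm)
  have hdec : σmin ^ 2 * δ x / (N - σmin ^ 2)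
      ≤ ∑ s ∈ Finset.univ \ {ik, ikm}, (Aᵀ s ⬝ᵥ r) ^ 2 / g s := by
    refine (div_le_div_of_nonneg_right hgrad hgap.le).trans ?_
    rw [Finset.sum_div]
    refine Finset.sum_le_sum fun s hs => ?_
    exact div_le_div_of_nonneg_left (sq_nonneg _) (hpos s (hmem hs).1 (hmem hs).2) (hgle s)
  rw [Finset.sum_congr rfl fun s hs => hstep s (hmem hs).1 (hmem hs).2, Finset.sum_sub_distrib,
    Finset.sum_const, nsmul_eq_mul, hcard, hκ2]
  have hrw : (1 - 1 / (((n : ℝ) - 2) * ((N - σmin ^ 2) / σmin ^ 2))) * δ x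
      = 1 / ((n : ℝ) - 2) * (((n : ℝ) - 2) * δ x - σmin ^ 2 * δ x / (N - σmin ^ 2)) := by
    field_simp
  rw [hrw]
  exact mul_le_mul_of_nonneg_left (by linarith) (by positivity)
end

section
/- (Theorem 3.2, full column rank form) Let A ∈ ℝ^{m×n} (n ≥ 3) have full column rank and nonzero columns, b ∈ ℝ^m, and let x* = (AᵀA)⁻¹Aᵀb be the unique least-squares solution of min‖Ax − b‖². Let x ∈ ℝ^n with residual r = b − Ax, and let i_{k−1}, i_k be two distinct column indices such that A_{i_k}ᵀ r = 0, A_{i_{k−1}}ᵀ r = 0, and ‖A_s‖² − ⟨A_s, A_{i_k}⟩²/‖A_{i_k}‖² > 0 for every s ∉ {i_k, i_{k−1}}. For each such s, let x⁺(s) = x + α_s e_s + β_s e_{i_k}, where g_s = ‖A_s‖² − ⟨A_s, A_{i_k}⟩²/‖A_{i_k}‖², α_s = (A_sᵀ r)/g_s, β_s = −(⟨A_{i_k}, A_s⟩/‖A_{i_k}‖²) α_s. Then (1/(n−2)) Σ_{s ≠ i_k, i_{k−1}} ‖x⁺(s) − x*‖²_{AᵀA} ≤ (1 − 1/((n−2)(κ_F²(A)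 − 1))) ‖x − x*‖²_{AᵀA}, where κ_F(A) = ‖A‖_F/σ_min(A). -/
open Matrix

/-- If every nonzero eigenvalue of an injective Gram matrix `AᵀA` is at least `c`, then
`c ‖v‖² ≤ ‖Av‖²` for all `v`. -/
theorem mul_dotProduct_self_le_of_eigenvalue_bound {m n : Type*} [Fintype m] [Fintype n]
    [DecidableEq n] (A : Matrix m n ℝ) (hA : Function.Injective A.mulVec) {c : ℝ}
    (hc : c ∈ lowerBounds
      {t : ℝ | t ≠ 0 ∧ ∃ v : n → ℝ, v ≠ 0 ∧ (Aᵀ * A).mulVec v = t • v})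
    (v : n → ℝ) : c * (v ⬝ᵥ v) ≤ A.mulVec v ⬝ᵥ A.mulVec v := by
  have hH : (Aᵀ * A - c • (1 : Matrix n n ℝ)).IsHermitian := by
    ext i j
    simp [Matrix.mul_apply, Matrix.one_apply, mul_comm, eq_comm]
  have hpsd : (Aᵀ * A - c • (1 : Matrix n n ℝ)).PosSemidef := by
    rw [hH.posSemidef_iff_eigenvalues_nonneg]
    intro i
    have hu := hH.mulVec_eigenvectorBasis i
    set u : n → ℝ := (hH.eigenvectorBasis i).ofLp
    have hu0 : u ≠ 0 := by
      intro h
      exact hH.eigenvectorBasis.toBasis.ne_zero i (by ext j; simpa using congrFun h j)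
    have heq : (Aᵀ * A).mulVec u = (hH.eigenvalues i + c) • u := by
      rw [Matrix.sub_mulVec, Matrix.smul_mulVec, Matrix.one_mulVec] at hu
      rw [add_smul, ← hu, sub_add_cancel]
    have hne : hH.eigenvalues i + c ≠ 0 := by
      intro h
      rw [h, zero_smul] at heq
      have hz : A.mulVec u = 0 := by
        rw [← Matrix.conjTranspose_eq_transpose_of_trivial] at heq
        exact (Matrix.conjTranspose_mul_self_mulVec_eq_zero A u).mp heq
      exact hu0 (hA (by rw [hz, Matrix.mulVec_zero]))
    have := hc ⟨hne, u, hu0, heq⟩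
    simp only [Pi.zero_apply]
    linarith
  have h := hpsd.dotProduct_mulVec_nonneg v
  rw [Matrix.sub_mulVec, Matrix.smul_mulVec, Matrix.one_mulVec, dotProduct_sub,
    dotProduct_smul, ← Matrix.mulVec_mulVec, Matrix.dotProduct_mulVec,
    Matrix.vecMul_transpose] at h
  simpa using h

/-- A lower bound `c ‖v‖² ≤ ‖Av‖²` on the Gram form also gives `c ‖Av‖² ≤ ‖AᵀAv‖²`. -/
theorem mul_dotProduct_self_mulVec_le {m n : Type*} [Fintype m] [Fintype n]
    (A : Matrix m n ℝ) {c : ℝ} (v : n → ℝ)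
    (h : c * (v ⬝ᵥ v) ≤ A.mulVec v ⬝ᵥ A.mulVec v) :
    c * (A.mulVec v ⬝ᵥ A.mulVec v) ≤
      Aᵀ.mulVec (A.mulVec v) ⬝ᵥ Aᵀ.mulVec (A.mulVec v) := by
  have hcs : (v ⬝ᵥ Aᵀ.mulVec (A.mulVec v)) ^ 2 ≤
      (v ⬝ᵥ v) * (Aᵀ.mulVec (A.mulVec v) ⬝ᵥ Aᵀ.mulVec (A.mulVec v)) := by
    simpa [dotProduct, sq] using Finset.sum_mul_sq_le_sq_mul_sq Finset.univ v
      (Aᵀ.mulVec (A.mulVec v))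
  rw [Matrix.dotProduct_mulVec, Matrix.vecMul_transpose] at hcs
  have hw : 0 ≤ A.mulVec v ⬝ᵥ A.mulVec v := dotProduct_self_star_nonneg _
  have hG : 0 ≤ Aᵀ.mulVec (A.mulVec v) ⬝ᵥ Aᵀ.mulVec (A.mulVec v) :=
    dotProduct_self_star_nonneg _
  rcases hw.eq_or_lt with h0 | h0
  · rw [← h0, mul_zero]
    exact hG
  rcases le_or_gt c 0 with hc | hc
  · exact (mul_nonpos_of_nonpos_of_nonneg hc hw).trans hG
  · refine le_of_mul_le_mul_right ?_ h0
    nlinarith [mul_le_mul_of_nonneg_left hcs hc.le, mul_le_mul_of_nonneg_right h hG]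

/-- Exact minimisation along the component `d = a - (⟨a,p⟩/‖p‖²) p` of `a` orthogonal to `p`. -/
theorem dotProduct_self_add_orthogonal_step {m : Type*} [Fintype m] (w a p : m → ℝ)
    (hp : p ⬝ᵥ p ≠ 0) (hpw : p ⬝ᵥ w = 0) {g α β : ℝ}
    (hg : g = a ⬝ᵥ a - (a ⬝ᵥ p) ^ 2 / (p ⬝ᵥ p)) (hg0 : g ≠ 0)
    (hα : α = -(a ⬝ᵥ w) / g) (hβ : β = -((p ⬝ᵥ a) / (p ⬝ᵥ p)) * α) :
    (w + α • a + β • p) ⬝ᵥ (w + α • a + β • p) = w ⬝ᵥ w - (a ⬝ᵥ w) ^ 2 / g := by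
  have hexp : (w + α • a + β • p) ⬝ᵥ (w + α • a + β • p) =
      w ⬝ᵥ w + 2 * α * (a ⬝ᵥ w) + α ^ 2 * (a ⬝ᵥ a) + 2 * α * β * (a ⬝ᵥ p)
        + β ^ 2 * (p ⬝ᵥ p) := by
    simp only [add_dotProduct, dotProduct_add, smul_dotProduct, dotProduct_smul, smul_eq_mul]
    rw [dotProduct_comm w a, dotProduct_comm w p, dotProduct_comm p a, hpw]
    ring
  have haa : a ⬝ᵥ a = g + (a ⬝ᵥ p) ^ 2 / (p ⬝ᵥ p) := by rw [hg]; ring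
  rw [hexp, hβ, dotProduct_comm p a, haa, hα]
  field_simp
  ring

/-- The sum of squares of the entries is the sum of the squared column norms. -/
theorem sum_sq_eq_sum_dotProduct_col {m n : Type*} [Fintype m] [Fintype n]
    (A : Matrix m n ℝ) : ∑ i, ∑ j, (A i j) ^ 2 = ∑ j, Aᵀ j ⬝ᵥ Aᵀ j := by
  rw [Finset.sum_comm]
  simp [dotProduct, sq]

/-- Theorem 3.2 (full column rank form): with `x* = (AᵀA)⁻¹Aᵀb`, the uniform average over
`s ∉ {i_k, i_{k−1}}` of `‖x⁺(s) − x*‖²_{AᵀA}` is at most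
`(1 − 1/((n−2)(κ_F²(A) − 1))) ‖x − x*‖²_{AᵀA}`, where `κ_F(A) = ‖A‖_F/σ_min(A)`. -/
theorem stmt_13 {m n : ℕ} (hn : 3 ≤ n) (A : Matrix (Fin m) (Fin n) ℝ)
    (hrank : LinearIndependent ℝ (fun j : Fin n => Aᵀ j))
    (hcol : ∀ j : Fin n, Aᵀ j ≠ 0)
    (b : Fin m → ℝ) (xstar : Fin n → ℝ)
    (hstar : xstar = (Aᵀ * A)⁻¹.mulVec (Aᵀ.mulVec b))
    (σmin : ℝ) (hσpos : 0 < σmin)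
    (hσ : IsLeast {t : ℝ | t ≠ 0 ∧ ∃ v : Fin n → ℝ, v ≠ 0 ∧ (Aᵀ * A).mulVec v = t • v}
      (σmin ^ 2))
    (κ : ℝ) (hκ : κ = Real.sqrt (∑ i, ∑ j, (A i j) ^ 2) / σmin)
    (x : Fin n → ℝ) (r : Fin m → ℝ) (hr : r = b - A.mulVec x)
    (ik ikm : Fin n) (hne : ik ≠ ikm)
    (hik : Aᵀ ik ⬝ᵥ r = 0) (hikm : Aᵀ ikm ⬝ᵥ r = 0)
    (g α β : Fin n → ℝ)
    (hg : ∀ s, g s = Aᵀ s ⬝ᵥ Aᵀ s - (Aᵀ s ⬝ᵥ Aᵀ ik) ^ 2 / (Aᵀ ik ⬝ᵥ Aᵀ ik))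
    (hpos : ∀ s : Fin n, s ≠ ik → s ≠ ikm → 0 < g s)
    (hα : ∀ s, α s = (Aᵀ s ⬝ᵥ r) / g s)
    (hβ : ∀ s, β s = -((Aᵀ ik ⬝ᵥ Aᵀ s) / (Aᵀ ik ⬝ᵥ Aᵀ ik)) * α s)
    (xplus : Fin n → Fin n → ℝ)
    (hxplus : ∀ s : Fin n, s ≠ ik → s ≠ ikm →
      xplus s = x + α s • (Pi.single s 1 : Fin n → ℝ) + β s • (Pi.single ik 1 : Fin n → ℝ)) :
    (1 / ((n : ℝ) - 2)) *
      ∑ s ∈ Finset.univ \ {ik, ikm},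
        A.mulVec (xplus s - xstar) ⬝ᵥ A.mulVec (xplus s - xstar)
    ≤ (1 - 1 / (((n : ℝ) - 2) * (κ ^ 2 - 1))) *
        (A.mulVec (x - xstar) ⬝ᵥ A.mulVec (x - xstar)) := by
  have hinj : Function.Injective A.mulVec := Matrix.mulVec_injective_iff.mpr hrank
  have hray := mul_dotProduct_self_le_of_eigenvalue_bound A hinj hσ.2
  have hunit : IsUnit (Aᵀ * A).det := by
    rw [← Matrix.isUnit_iff_isUnit_det, ← Matrix.mulVec_injective_iff_isUnit]
    refine (injective_iff_map_eq_zero (Matrix.mulVecLin (Aᵀ * A))).mpr fun u hu => ?_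
    rw [Matrix.mulVecLin_apply] at hu
    rw [← Matrix.conjTranspose_eq_transpose_of_trivial] at hu
    exact hinj (((Matrix.conjTranspose_mul_self_mulVec_eq_zero A u).mp hu).trans
      (Matrix.mulVec_zero A).symm)
  have hnormal : (Aᵀ * A).mulVec xstar = Aᵀ.mulVec b := by
    rw [hstar, Matrix.mulVec_mulVec, Matrix.mul_nonsing_inv _ hunit, Matrix.one_mulVec]
  set w : Fin m → ℝ := A.mulVec (x - xstar) with hw
  have hres : ∀ s, Aᵀ s ⬝ᵥ r = -(Aᵀ s ⬝ᵥ w) := by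
    have h : Aᵀ.mulVec r = -Aᵀ.mulVec w := by
      rw [hr, hw, Matrix.mulVec_sub, Matrix.mulVec_sub, Matrix.mulVec_sub, ← hnormal,
        ← Matrix.mulVec_mulVec, neg_sub]
    exact fun s => congrFun h s
  have hcol_pos : ∀ j, 0 < Aᵀ j ⬝ᵥ Aᵀ j := fun j =>
    (dotProduct_self_star_nonneg _).lt_of_ne' (dotProduct_self_eq_zero.not.mpr (hcol j))
  have hstep : ∀ s, s ≠ ik → s ≠ ikm →
      A.mulVec (xplus s - xstar) ⬝ᵥ A.mulVec (xplus s - xstar) =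
        w ⬝ᵥ w - (Aᵀ s ⬝ᵥ w) ^ 2 / g s := by
    intro s h1 h2
    have hx : A.mulVec (xplus s - xstar) = w + α s • Aᵀ s + β s • Aᵀ ik := by
      have : xplus s - xstar = (x - xstar) + α s • (Pi.single s 1 : Fin n → ℝ)
          + β s • (Pi.single ik 1 : Fin n → ℝ) := by
        rw [hxplus s h1 h2]; abel
      rw [this, Matrix.mulVec_add, Matrix.mulVec_add, Matrix.mulVec_smul, Matrix.mulVec_smul,
        Matrix.mulVec_single_one, Matrix.mulVec_single_one]
      rfl
    rw [hx]
    refine dotProduct_self_add_orthogonal_step w _ _ (hcol_pos ik).ne' ?_ (hg s)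
      (hpos s h1 h2).ne' ?_ (hβ s)
    · have := hres ik
      linarith
    · rw [hα s, hres s]
  set F : ℝ := ∑ i, ∑ j, (A i j) ^ 2
  have hF_cols : F = ∑ j, Aᵀ j ⬝ᵥ Aᵀ j := sum_sq_eq_sum_dotProduct_col A
  have hg_le : ∀ s, s ≠ ik → g s ≤ F - σmin ^ 2 := by
    intro s hs
    have h1 : Aᵀ s ⬝ᵥ Aᵀ s + Aᵀ ik ⬝ᵥ Aᵀ ik ≤ F := by
      rw [hF_cols, ← Finset.sum_pair (f := fun j => Aᵀ j ⬝ᵥ Aᵀ j) hs]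
      exact Finset.sum_le_sum_of_subset_of_nonneg (Finset.subset_univ _)
        fun j _ _ => (hcol_pos j).le
    have h2 : σmin ^ 2 ≤ Aᵀ ik ⬝ᵥ Aᵀ ik := by
      have h := hray (Pi.single ik 1)
      rw [Matrix.mulVec_single_one] at h
      rwa [single_one_dotProduct, Pi.single_eq_same, mul_one] at h
    have h3 : 0 ≤ (Aᵀ s ⬝ᵥ Aᵀ ik) ^ 2 / (Aᵀ ik ⬝ᵥ Aᵀ ik) :=
      div_nonneg (sq_nonneg _) (hcol_pos ik).le
    rw [hg s]
    linarith
  have hmem : ∀ s, s ∈ Finset.univ \ ({ik, ikm} : Finset (Fin n)) ↔ s ≠ ik ∧ s ≠ ikm := by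
    simp
  have hcard : ((Finset.univ \ ({ik, ikm} : Finset (Fin n))).card : ℝ) = n - 2 := by
    rw [Finset.card_sdiff_of_subset (Finset.subset_univ _), Finset.card_pair hne,
      Finset.card_univ, Fintype.card_fin, Nat.cast_sub (by omega)]
    norm_num
  have hn2 : (0 : ℝ) < n - 2 := by
    have : (3 : ℝ) ≤ n := by exact_mod_cast hn
    linarith
  have hD : 0 < F - σmin ^ 2 := by
    have hc : 0 < (Finset.univ \ ({ik, ikm} : Finset (Fin n))).card := by
      exact_mod_cast hcard ▸ hn2
    obtain ⟨s, hs⟩ := Finset.card_pos.mp hc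
    rw [hmem] at hs
    exact (hpos s hs.1 hs.2).trans_le (hg_le s hs.1)
  have hgrad : σmin ^ 2 * (w ⬝ᵥ w) ≤
      ∑ s ∈ Finset.univ \ {ik, ikm}, (Aᵀ s ⬝ᵥ w) ^ 2 := by
    refine (mul_dotProduct_self_mulVec_le A _ (hray (x - xstar))).trans_eq ?_
    have h : Aᵀ.mulVec w ⬝ᵥ Aᵀ.mulVec w = ∑ s, (Aᵀ s ⬝ᵥ w) ^ 2 := by
      simp only [sq]
      rfl
    rw [← hw, h]
    symm
    refine Finset.sum_subset (Finset.subset_univ _) fun s _ hs => ?_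
    rw [← neg_sq, ← hres s]
    rw [hmem, not_and_or, not_not, not_not] at hs
    rcases hs with rfl | rfl
    · rw [hik, zero_pow two_ne_zero]
    · rw [hikm, zero_pow two_ne_zero]
  have hdec : σmin ^ 2 * (w ⬝ᵥ w) / (F - σmin ^ 2) ≤
      ∑ s ∈ Finset.univ \ {ik, ikm}, (Aᵀ s ⬝ᵥ w) ^ 2 / g s := by
    refine (div_le_div_of_nonneg_right hgrad hD.le).trans ?_
    rw [Finset.sum_div]
    refine Finset.sum_le_sum fun s hs => ?_
    rw [hmem] at hs
    exact div_le_div_of_nonneg_left (sq_nonneg _) (hpos s hs.1 hs.2) (hg_le s hs.1)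
  have hκ2 : κ ^ 2 - 1 = (F - σmin ^ 2) / σmin ^ 2 := by
    have hF0 : 0 ≤ F := Finset.sum_nonneg fun i _ => Finset.sum_nonneg fun j _ => sq_nonneg _
    rw [hκ, div_pow, Real.sq_sqrt hF0, sub_div, div_self (pow_pos hσpos 2).ne']
  rw [Finset.sum_congr rfl fun s hs => hstep s ((hmem s).mp hs).1 ((hmem s).mp hs).2,
    Finset.sum_sub_distrib, Finset.sum_const, nsmul_eq_mul, hcard, hκ2]
  have hrhs : (1 - 1 / (((n : ℝ) - 2) * ((F - σmin ^ 2) / σmin ^ 2))) * (w ⬝ᵥ w) =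
      1 / ((n : ℝ) - 2) *
        (((n : ℝ) - 2) * (w ⬝ᵥ w) - σmin ^ 2 * (w ⬝ᵥ w) / (F - σmin ^ 2)) := by
    have := hn2.ne'
    have := hD.ne'
    have := hσpos.ne'
    field_simp
  rw [hrhs]
  exact mul_le_mul_of_nonneg_left (sub_le_sub_left hdec _) (one_div_pos.mpr hn2).le
end

section
/- (Remark 7) Let A ∈ ℝ^{m×n} (n ≥ 3) have all columns of unit Euclidean norm, b ∈ ℝ^m, and let x̃ ∈ ℝ^n satisfy AᵀAx̃ = Aᵀb. Let x ∈ ℝ^n with residual r = b − Ax, and let i_{k−1}, i_k be two distinct column indices such that A_{i_k}ᵀ r = 0, A_{i_{k−1}}ᵀ r = 0, and 1 − ⟨A_s, A_{i_k}⟩² > 0 for every s ∉ {i_k, i_{k−1}}. Set γ = min_{s ≠ i_k, i_{k−1}} |⟨A_s, A_{i_k}⟩| and assume γ < 1. Then (1/(n−2)) Σ_{s ≠ i_k, i_{k−1}} (A_sᵀ r)² / (1 − ⟨A_s, A_{i_k}⟩²) ≥ σ_min²(A) ‖x̃ − x‖²_{AᵀA} / ((1 − γ²)(‖A‖_F² −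 2)). -/
open Matrix

/-- If every eigenvalue of a real symmetric matrix `G` is zero or at least `c`,
then `c • G ≤ G ^ 2` as quadratic forms. -/
theorem Matrix.IsHermitian.mul_dotProduct_mulVec_le {ι : Type*} [Fintype ι] [DecidableEq ι]
    {G : Matrix ι ι ℝ} (hG : G.IsHermitian) {c : ℝ} (hc : 0 ≤ c)
    (h : ∀ (t : ℝ) (v : ι → ℝ), t ≠ 0 → v ≠ 0 → G *ᵥ v = t • v → c ≤ t) (z : ι → ℝ) :
    c * (z ⬝ᵥ G *ᵥ z) ≤ (G *ᵥ z) ⬝ᵥ (G *ᵥ z) := by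
  let e := hG.eigenvectorBasis
  have hsum : ∀ u v : ι → ℝ, u ⬝ᵥ v = ∑ i, (u ⬝ᵥ ⇑(e i)) * (⇑(e i) ⬝ᵥ v) := fun u v => by
    have := e.sum_inner_mul_inner (WithLp.toLp 2 u) (WithLp.toLp 2 v)
    simp only [EuclideanSpace.inner_eq_star_dotProduct, star_trivial] at this
    rw [dotProduct_comm u v, ← this]
    exact Finset.sum_congr rfl fun i _ => by
      rw [dotProduct_comm u, dotProduct_comm v]
  have hev : ∀ i, ⇑(e i) ⬝ᵥ G *ᵥ z = hG.eigenvalues i * (⇑(e i) ⬝ᵥ z) := fun i => by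
    have hT : Gᵀ = G := by simpa [Matrix.IsHermitian, conjTranspose] using hG
    rw [dotProduct_mulVec, ← mulVec_transpose, hT, hG.mulVec_eigenvectorBasis, smul_dotProduct,
      smul_eq_mul]
  rw [hsum z, hsum (G *ᵥ z), Finset.mul_sum]
  refine Finset.sum_le_sum fun i _ => ?_
  rw [dotProduct_comm (G *ᵥ z), dotProduct_comm z, hev]
  have hne : (⇑(e i) : ι → ℝ) ≠ 0 := fun h0 =>
    e.toBasis.ne_zero i (by
      rw [OrthonormalBasis.coe_toBasis]
      ext j
      exact congrFun h0 j)
  by_cases h0 : hG.eigenvalues i = 0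
  · simp [h0]
  · have hle := h _ _ h0 hne (hG.mulVec_eigenvectorBasis i)
    nlinarith [mul_nonneg (mul_nonneg (sub_nonneg.2 hle) (hc.trans hle))
      (sq_nonneg (⇑(e i) ⬝ᵥ z))]

/-- Remark 7: for `A` with unit columns,
`(1/(n−2)) Σ_{s ≠ i_k, i_{k−1}} (A_sᵀ r)²/(1 − ⟨A_s,A_{i_k}⟩²)
  ≥ σ_min²(A)‖x̃ − x‖²_{AᵀA} / ((1 − γ²)(‖A‖_F² − 2))`,
where `γ = min_{s ≠ i_k, i_{k−1}} |⟨A_s, A_{i_k}⟩|`. -/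
theorem stmt_14 {m n : ℕ} (hn : 3 ≤ n) (A : Matrix (Fin m) (Fin n) ℝ)
    (hunit : ∀ j : Fin n, Aᵀ j ⬝ᵥ Aᵀ j = 1)
    (b : Fin m → ℝ) (xtil : Fin n → ℝ)
    (hls : (Aᵀ * A).mulVec xtil = Aᵀ.mulVec b)
    (σmin : ℝ) (hσpos : 0 < σmin)
    (hσ : IsLeast {t : ℝ | t ≠ 0 ∧ ∃ v : Fin n → ℝ, v ≠ 0 ∧ (Aᵀ * A).mulVec v = t • v}
      (σmin ^ 2))
    (x : Fin n → ℝ) (r : Fin m → ℝ) (hr : r = b - A.mulVec x)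
    (ik ikm : Fin n) (hne : ik ≠ ikm)
    (hik : Aᵀ ik ⬝ᵥ r = 0) (hikm : Aᵀ ikm ⬝ᵥ r = 0)
    (hpos : ∀ s : Fin n, s ≠ ik → s ≠ ikm → 0 < 1 - (Aᵀ s ⬝ᵥ Aᵀ ik) ^ 2)
    (γ : ℝ)
    (hγ : IsLeast ((fun s : Fin n => |Aᵀ s ⬝ᵥ Aᵀ ik|) '' {s | s ≠ ik ∧ s ≠ ikm}) γ)
    (hγ1 : γ < 1) :
    (1 / ((n : ℝ) - 2)) *
      ∑ s ∈ Finset.univ \ {ik, ikm}, (Aᵀ s ⬝ᵥ r) ^ 2 / (1 - (Aᵀ s ⬝ᵥ Aᵀ ik) ^ 2)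
    ≥ σmin ^ 2 * (A.mulVec (xtil - x) ⬝ᵥ A.mulVec (xtil - x))
      / ((1 - γ ^ 2) * ((∑ i, ∑ j, (A i j) ^ 2) - 2)) := by
  have hG : (Aᵀ * A).IsHermitian := by
    simpa using isHermitian_conjTranspose_mul_self A
  have hgrad : Aᵀ *ᵥ r = (Aᵀ * A) *ᵥ (xtil - x) := by
    rw [hr, mulVec_sub, mulVec_sub, hls, mulVec_mulVec]
  have hσle := hG.mul_dotProduct_mulVec_le (sq_nonneg σmin)
    (fun t v ht hv hGv => hσ.2 ⟨ht, v, hv, hGv⟩) (xtil - x)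
  rw [← hgrad] at hσle
  have hquad : A *ᵥ (xtil - x) ⬝ᵥ A *ᵥ (xtil - x) = (xtil - x) ⬝ᵥ Aᵀ *ᵥ r := by
    rw [hgrad, ← mulVec_mulVec, dotProduct_mulVec _ Aᵀ, vecMul_transpose]
  have hnorm : (Aᵀ *ᵥ r) ⬝ᵥ (Aᵀ *ᵥ r)
      = ∑ s ∈ Finset.univ \ {ik, ikm}, (Aᵀ s ⬝ᵥ r) ^ 2 := by
    rw [← add_zero (∑ s ∈ Finset.univ \ {ik, ikm}, (Aᵀ s ⬝ᵥ r) ^ 2)]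
    have hzero : ∑ s ∈ ({ik, ikm} : Finset (Fin n)), (Aᵀ s ⬝ᵥ r) ^ 2 = 0 := by
      rw [Finset.sum_pair hne, hik, hikm]
      norm_num
    rw [← hzero, Finset.sum_sdiff (Finset.subset_univ _)]
    exact Finset.sum_congr rfl fun s _ => (sq _).symm
  have hfrob : ∑ i, ∑ j, (A i j) ^ 2 = (n : ℝ) := by
    rw [Finset.sum_comm, Finset.sum_congr rfl fun j _ => (?_ : ∑ i, (A i j) ^ 2 = 1)]
    · simp
    · rw [← hunit j]
      exact Finset.sum_congr rfl fun i _ => sq _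
  have hγ0 : 0 ≤ γ := by
    obtain ⟨s, -, hs⟩ := hγ.1
    exact hs ▸ abs_nonneg _
  have hγpos : 0 < 1 - γ ^ 2 := by nlinarith
  have hn2 : (0 : ℝ) < n - 2 := by
    have : (3 : ℝ) ≤ n := by exact_mod_cast hn
    linarith
  have hterms : (∑ s ∈ Finset.univ \ {ik, ikm}, (Aᵀ s ⬝ᵥ r) ^ 2) / (1 - γ ^ 2)
      ≤ ∑ s ∈ Finset.univ \ {ik, ikm}, (Aᵀ s ⬝ᵥ r) ^ 2 / (1 - (Aᵀ s ⬝ᵥ Aᵀ ik) ^ 2) := by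
    rw [Finset.sum_div]
    refine Finset.sum_le_sum fun s hs => ?_
    simp only [Finset.mem_sdiff, Finset.mem_univ, true_and, Finset.mem_insert,
      Finset.mem_singleton, not_or] at hs
    have hγs : γ ≤ |Aᵀ s ⬝ᵥ Aᵀ ik| := hγ.2 ⟨s, hs, rfl⟩
    refine div_le_div_of_nonneg_left (sq_nonneg _) (hpos s hs.1 hs.2) ?_
    rw [← sq_abs (Aᵀ s ⬝ᵥ Aᵀ ik)]
    gcongr
  rw [hfrob, hquad, ge_iff_le, ← div_div, one_div_mul_eq_div]
  rw [hnorm] at hσle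
  gcongr
  exact (div_le_div_of_nonneg_right hσle hγpos.le).trans hterms
end
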